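/- Let P be a Markov operator on L¹(X,m) and let 𝒜 ⊆ Σ be an admissible family. Suppose there exists a measurable function u : X → [0,∞] with u > 0 a.e. that is locally integrable with respect to 𝒜 and properly subinvariant, i.e., there is a sequence (fₖ) of nonnegative functions in L¹(X,m) increasing pointwise a.e. to u such that the a.e. pointwise limit P u of P fₖ satisfies P u < u a.e. Then P is sweeping with respect to 𝒜: lim_{n→∞} ∫_A (Pⁿ f) dm = 0 for every A ∈ 𝒜 and every f ∈ L¹(X,m). -/

import Mathlib

open MeasureTheory Filter Topology ENNReal

/-- A Markov operator on `L¹(X,m)`, represented by a linear operator on (representatives of)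
functions: it maps integrable functions to integrable functions, is positive
(`f ≥ 0` a.e. implies `P f ≥ 0` a.e.) and is an `L¹`-contraction. -/
def IsMarkovOperator {X : Type*} [MeasurableSpace X] (m : Measure X)
    (P : (X → ℝ) →ₗ[ℝ] (X → ℝ)) : Prop :=
  (∀ f : X → ℝ, Integrable f m → Integrable (P f) m) ∧
  (∀ f : X → ℝ, Integrable f m → 0 ≤ᵐ[m] f → 0 ≤ᵐ[m] P f) ∧
  (∀ f : X → ℝ, Integrable f m → ∫ x, |P f x| ∂m ≤ ∫ x, |f x| ∂m)

/-- An admissible family `𝒜` of measurable sets: each member is measurable of finite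
measure, `𝒜` is closed under pairwise unions, and a countable subfamily covers `X`
up to an `m`-null set. -/
def AdmissibleFamily {X : Type*} [MeasurableSpace X] (m : Measure X)
    (𝒜 : Set (Set X)) : Prop :=
  (∀ A ∈ 𝒜, MeasurableSet A ∧ m A < ⊤) ∧
  (∀ A ∈ 𝒜, ∀ B ∈ 𝒜, A ∪ B ∈ 𝒜) ∧
  (∃ g : ℕ → Set X, (∀ n, g n ∈ 𝒜) ∧ m (⋃ n, g n)ᶜ = 0)

/-- `u : X → [0,∞]` is properly subinvariant for `P`: there is a sequence `(fₖ)` of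
nonnegative `L¹` functions increasing pointwise a.e. to `u` such that the a.e. pointwise
limit `Pu` of `P fₖ` (the extension of `P` to `u`) satisfies `Pu < u` a.e. -/
def ProperlySubinvariant {X : Type*} [MeasurableSpace X] (m : Measure X)
    (P : (X → ℝ) →ₗ[ℝ] (X → ℝ)) (u : X → ℝ≥0∞) : Prop :=
  ∃ f : ℕ → X → ℝ,
    (∀ k, Integrable (f k) m) ∧ (∀ k, 0 ≤ᵐ[m] f k) ∧
    (∀ᵐ x ∂m, Monotone fun k => f k x) ∧
    (∀ᵐ x ∂m, Filter.Tendsto (fun k => ENNReal.ofReal (f k x)) atTop (𝓝 (u x))) ∧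
    ∃ Pu : X → ℝ≥0∞,
      (∀ᵐ x ∂m, Filter.Tendsto (fun k => ENNReal.ofReal (P (f k) x)) atTop (𝓝 (Pu x))) ∧
      (∀ᵐ x ∂m, Pu x < u x)

namespace IsMarkovOperator

variable {X : Type*} [MeasurableSpace X] {m : Measure X} {P : (X → ℝ) →ₗ[ℝ] (X → ℝ)}

lemma mono (hP : IsMarkovOperator m P) {f g : X → ℝ} (hf : Integrable f m)
    (hg : Integrable g m) (hfg : f ≤ᵐ[m] g) : P f ≤ᵐ[m] P g := by
  have h := hP.2.1 (g - f) (hg.sub hf) (by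
    filter_upwards [hfg] with x hx
    simpa using hx)
  rw [map_sub] at h
  filter_upwards [h] with x hx
  simpa using hx

lemma abs_le (hP : IsMarkovOperator m P) {f g : X → ℝ} (hf : Integrable f m)
    (hg : Integrable g m) (hfg : ∀ᵐ x ∂m, |f x| ≤ g x) : ∀ᵐ x ∂m, |P f x| ≤ P g x := by
  have h₁ := hP.mono hf hg (hfg.mono fun x hx => (le_abs_self _).trans hx)
  have h₂ := hP.mono hf.neg hg (hfg.mono fun x hx => (neg_le_abs _).trans hx)
  rw [map_neg] at h₂
  filter_upwards [h₁, h₂] with x hx₁ hx₂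
  exact abs_le'.2 ⟨hx₁, hx₂⟩

lemma pow (hP : IsMarkovOperator m P) (n : ℕ) : IsMarkovOperator m (P ^ n) := by
  induction n with
  | zero => exact ⟨fun f hf => hf, fun f _ hf => hf, fun f _ => le_rfl⟩
  | succ n ih =>
    simp only [pow_succ', IsMarkovOperator, Module.End.mul_apply]
    exact ⟨fun f hf => hP.1 _ (ih.1 f hf),
      fun f hf h => hP.2.1 _ (ih.1 f hf) (ih.2.1 f hf h),
      fun f hf => (hP.2.2 _ (ih.1 f hf)).trans (ih.2.2 f hf)⟩

/-- Monotonicity of the extension of `P` to `[0,∞]`-valued functions, tested on an integrable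
function below `u = lim f k`. -/
lemma ofReal_apply_le_of_le (hP : IsMarkovOperator m P) {u Pu : X → ℝ≥0∞} {f : ℕ → X → ℝ}
    (hf : ∀ k, Integrable (f k) m) (hf0 : ∀ k, 0 ≤ᵐ[m] f k)
    (hmono : ∀ᵐ x ∂m, Monotone fun k => f k x)
    (hlim : ∀ᵐ x ∂m, Tendsto (fun k => ENNReal.ofReal (f k x)) atTop (𝓝 (u x)))
    (hPlim : ∀ᵐ x ∂m, Tendsto (fun k => ENNReal.ofReal (P (f k) x)) atTop (𝓝 (Pu x)))
    {h : X → ℝ} (hh : Integrable h m) (hh0 : 0 ≤ᵐ[m] h)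
    (hhu : ∀ᵐ x ∂m, ENNReal.ofReal (h x) ≤ u x) :
    ∀ᵐ x ∂m, ENNReal.ofReal (P h x) ≤ Pu x := by
  have hmin : ∀ k, Integrable (h ⊓ f k) m := fun k => hh.inf (hf k)
  have hr : ∀ k, Integrable (h - h ⊓ f k) m := fun k => hh.sub (hmin k)
  have hPmono : ∀ᵐ x ∂m, Monotone fun k => P (f k) x := by
    have : ∀ k, P (f k) ≤ᵐ[m] P (f (k + 1)) := fun k =>
      hP.mono (hf k) (hf (k + 1)) (hmono.mono fun x hx => hx k.le_succ)
    filter_upwards [ae_all_iff.2 this] with x hx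
    exact monotone_nat_of_le_succ hx
  have hbound : ∀ᵐ x ∂m, ∀ k,
      ENNReal.ofReal (P h x) ≤ Pu x + ENNReal.ofReal (P (h - h ⊓ f k) x) := by
    refine ae_all_iff.2 fun k => ?_
    filter_upwards [hPmono, hPlim,
      hP.mono (hmin k) (hf k) (Eventually.of_forall fun x => min_le_right _ _)]
      with x hx₁ hx₂ hx₃
    have hle : ENNReal.ofReal (P (f k) x) ≤ Pu x :=
      Monotone.ge_of_tendsto (fun i j hij => ENNReal.ofReal_le_ofReal (hx₁ hij)) hx₂ k
    have heq : P h x = P (h ⊓ f k) x + P (h - h ⊓ f k) x := by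
      rw [map_sub]; simp
    rw [heq]
    exact ENNReal.ofReal_add_le.trans
      (add_le_add ((ENNReal.ofReal_le_ofReal hx₃).trans hle) le_rfl)
  have hint : Tendsto (fun k => ∫ x, |(h - h ⊓ f k) x| ∂m) atTop (𝓝 0) := by
    rw [show (0 : ℝ) = ∫ _, (0 : ℝ) ∂m by simp]
    refine tendsto_integral_of_dominated_convergence (fun x => |h x|)
      (fun k => (hr k).abs.aestronglyMeasurable) hh.abs (fun k => ?_) ?_
    · filter_upwards [hh0, hf0 k] with x hx₁ hx₂
      simp only [Pi.zero_apply] at hx₁ hx₂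
      simp only [Pi.sub_apply, Pi.inf_apply, Real.norm_eq_abs, abs_abs]
      have := le_min hx₁ hx₂
      have := min_le_left (h x) (f k x)
      rw [abs_of_nonneg (by linarith), abs_of_nonneg hx₁]
      linarith
    · filter_upwards [hh0, ae_all_iff.2 hf0, hlim, hhu] with x hx₁ hx₂ hx₃ hx₄
      have h₁ : Tendsto (fun k => (min (ENNReal.ofReal (h x)) (ENNReal.ofReal (f k x))).toReal)
          atTop (𝓝 (h x)) := by
        have := (ENNReal.tendsto_toReal (ENNReal.ofReal_ne_top (r := h x))).comp
          ((min_eq_left hx₄) ▸ (tendsto_const_nhds (x := ENNReal.ofReal (h x))).min hx₃)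
        rwa [ENNReal.toReal_ofReal hx₁] at this
      have h₂ : ∀ k, (min (ENNReal.ofReal (h x)) (ENNReal.ofReal (f k x))).toReal
          = min (h x) (f k x) := fun k => by
        rw [← (ENNReal.ofReal_mono).map_min, ENNReal.toReal_ofReal (le_min hx₁ (hx₂ k))]
      simp only [h₂] at h₁
      simpa using ((tendsto_const_nhds (x := h x)).sub h₁).abs
  have hinf : ∀ᵐ x ∂m, ⨅ k, ENNReal.ofReal (P (h - h ⊓ f k) x) = 0 := by
    have hmeas : AEMeasurable (fun x => ⨅ k, ENNReal.ofReal (P (h - h ⊓ f k) x)) m :=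
      AEMeasurable.iInf fun k => (hP.1 _ (hr k)).aestronglyMeasurable.aemeasurable.ennreal_ofReal
    refine (lintegral_eq_zero_iff' hmeas).1 (le_antisymm ?_ zero_le)
    have hint' := ENNReal.tendsto_ofReal hint
    rw [ENNReal.ofReal_zero] at hint'
    refine ge_of_tendsto' hint' fun k => ?_
    calc ∫⁻ x, ⨅ k, ENNReal.ofReal (P (h - h ⊓ f k) x) ∂m
        ≤ ∫⁻ x, ENNReal.ofReal |P (h - h ⊓ f k) x| ∂m :=
          lintegral_mono fun x => (iInf_le _ k).trans (ENNReal.ofReal_le_ofReal (le_abs_self _))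
      _ = ENNReal.ofReal (∫ x, |P (h - h ⊓ f k) x| ∂m) :=
          (ofReal_integral_eq_lintegral_ofReal (hP.1 _ (hr k)).abs
            (Eventually.of_forall fun x => abs_nonneg _)).symm
      _ ≤ _ := ENNReal.ofReal_le_ofReal (hP.2.2 _ (hr k))
  filter_upwards [hbound, hinf] with x hx₁ hx₂
  have := le_iInf hx₁
  rwa [← ENNReal.add_iInf, hx₂, add_zero] at this

/-- If the integrals of `P ^ n g` over `A` tend to zero for one integrable `g > 0`, then so do
those of `P ^ n f` for every integrable `f`. -/
lemma tendsto_setIntegral_pow (hP : IsMarkovOperator m P) {A : Set X} {g : X → ℝ}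
    (hg : Integrable g m) (hg0 : ∀ᵐ x ∂m, 0 < g x)
    (hA : Tendsto (fun n : ℕ => ∫ x in A, (P ^ n) g x ∂m) atTop (𝓝 0))
    {f : X → ℝ} (hf : Integrable f m) :
    Tendsto (fun n : ℕ => ∫ x in A, (P ^ n) f x ∂m) atTop (𝓝 0) := by
  set c : ℕ → X → ℝ := fun K => (-((K : ℝ) • g)) ⊔ (f ⊓ ((K : ℝ) • g)) with hc
  have hKg : ∀ K : ℕ, Integrable ((K : ℝ) • g) m := fun K => hg.smul _
  have hci : ∀ K, Integrable (c K) m := fun K => (hKg K).neg.sup (hf.inf (hKg K))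
  have hcg : ∀ K, ∀ᵐ x ∂m, |c K x| ≤ ((K : ℝ) • g) x := fun K => by
    filter_upwards [hg0] with x hx
    have : 0 ≤ (K : ℝ) * g x := by positivity
    simp only [hc, Pi.sup_apply, Pi.inf_apply, Pi.neg_apply, Pi.smul_apply, smul_eq_mul]
    exact _root_.abs_le.2 ⟨le_max_left _ _, max_le (by linarith) (min_le_right _ _)⟩
  have hlim : Tendsto (fun K => ∫ x, |(f - c K) x| ∂m) atTop (𝓝 0) := by
    rw [show (0 : ℝ) = ∫ _, (0 : ℝ) ∂m by simp]
    refine tendsto_integral_of_dominated_convergence (fun x => |f x|)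
      (fun K => (hf.sub (hci K)).abs.aestronglyMeasurable) hf.abs (fun K => ?_) ?_
    · filter_upwards [hg0] with x hx
      have : 0 ≤ (K : ℝ) * g x := by positivity
      simp only [hc, Pi.sub_apply, Pi.sup_apply, Pi.inf_apply, Pi.neg_apply, Pi.smul_apply,
        smul_eq_mul, Real.norm_eq_abs, abs_abs]
      grind
    · filter_upwards [hg0] with x hx
      obtain ⟨N, hN⟩ := exists_nat_ge (|f x| / g x)
      refine tendsto_const_nhds.congr' ?_
      filter_upwards [eventually_ge_atTop N] with K hK
      have h₁ : |f x| ≤ (K : ℝ) * g x := by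
        rw [div_le_iff₀ hx] at hN
        exact hN.trans (by gcongr)
      obtain ⟨h₂, h₃⟩ := _root_.abs_le.1 h₁
      simp [hc, min_eq_left h₃, max_eq_right h₂]
  rw [Metric.tendsto_atTop]
  intro ε hε
  obtain ⟨K, hK⟩ := (hlim.eventually_lt_const (half_pos hε)).exists
  have hKA : Tendsto (fun n : ℕ => (K : ℝ) * ∫ x in A, (P ^ n) g x ∂m) atTop (𝓝 0) := by
    simpa using hA.const_mul (K : ℝ)
  obtain ⟨N, hN⟩ := eventually_atTop.1 (hKA.eventually_lt_const (half_pos hε))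
  refine ⟨N, fun n hn => ?_⟩
  have hPn := hP.pow n
  have hsplit : ∫ x in A, (P ^ n) f x ∂m
      = (∫ x in A, (P ^ n) (c K) x ∂m) + ∫ x in A, (P ^ n) (f - c K) x ∂m := by
    rw [← integral_add (hPn.1 _ (hci K)).integrableOn
      (hPn.1 _ (hf.sub (hci K))).integrableOn]
    congr 1
    ext x
    rw [map_sub]
    simp
  have h₁ : |∫ x in A, (P ^ n) (c K) x ∂m| ≤ (K : ℝ) * ∫ x in A, (P ^ n) g x ∂m := by
    rw [← integral_const_mul]
    refine abs_integral_le_integral_abs.trans (integral_mono_ae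
      (hPn.1 _ (hci K)).abs.integrableOn ((hPn.1 _ hg).const_mul _).integrableOn ?_)
    filter_upwards [ae_restrict_of_ae (hPn.abs_le (hci K) (hKg K) (hcg K))] with x hx
    simpa using hx
  have h₂ : |∫ x in A, (P ^ n) (f - c K) x ∂m| ≤ ∫ x, |(f - c K) x| ∂m :=
    abs_integral_le_integral_abs.trans <|
      (setIntegral_le_integral (hPn.1 _ (hf.sub (hci K))).abs
        (Eventually.of_forall fun x => abs_nonneg _)).trans (hPn.2.2 _ (hf.sub (hci K)))
  rw [Real.dist_eq, sub_zero, hsplit]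
  have := abs_add_le (∫ x in A, (P ^ n) (c K) x ∂m) (∫ x in A, (P ^ n) (f - c K) x ∂m)
  have := hN n hn
  linarith

end IsMarkovOperator

/-- A properly subinvariant function `u` dominates the partial sums of the orbit of some
strictly positive integrable function. -/
lemma ProperlySubinvariant.exists_sum_pow_le {X : Type*} [MeasurableSpace X] {m : Measure X}
    [SigmaFinite m] {P : (X → ℝ) →ₗ[ℝ] (X → ℝ)} (hP : IsMarkovOperator m P) {u : X → ℝ≥0∞}
    (hu : AEMeasurable u m) (hsub : ProperlySubinvariant m P u) :
    ∃ g : X → ℝ, Integrable g m ∧ (∀ᵐ x ∂m, 0 < g x) ∧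
      ∀ N, ∀ᵐ x ∂m, ENNReal.ofReal ((∑ n ∈ Finset.range N, (P ^ n) g) x) ≤ u x := by
  obtain ⟨f, hf, hf0, hmono, hlim, Pu, hPlim, hlt⟩ := hsub
  obtain ⟨w, hw0, hwm, hw⟩ := exists_pos_lintegral_lt_of_sigmaFinite m one_ne_zero
  have hPu : AEMeasurable Pu m := aemeasurable_of_tendsto_metrizable_ae atTop
    (fun k => (hP.1 _ (hf k)).aestronglyMeasurable.aemeasurable.ennreal_ofReal) hPlim
  have hmin : ∀ x, min (u x - Pu x) (w x) ≠ ⊤ := fun x =>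
    ((min_le_right _ _).trans_lt ENNReal.coe_lt_top).ne
  set g : X → ℝ := fun x => (min (u x - Pu x) (w x)).toReal with hgdef
  have hg : Integrable g m := by
    refine integrable_toReal_of_lintegral_ne_top
      ((hu.sub hPu).min hwm.coe_nnreal_ennreal.aemeasurable) (ne_of_lt ?_)
    exact (lintegral_mono fun x => min_le_right _ _).trans_lt (hw.trans ENNReal.one_lt_top)
  refine ⟨g, hg, ?_, ?_⟩
  · filter_upwards [hlt] with x hx
    exact ENNReal.toReal_pos
      (lt_min (tsub_pos_of_lt hx) (ENNReal.coe_pos.2 (hw0 x))).ne' (hmin x)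
  · have hS : ∀ N, Integrable (∑ n ∈ Finset.range N, (P ^ n) g) m := fun N =>
      integrable_finsetSum' _ fun n _ => (hP.pow n).1 _ hg
    have hS0 : ∀ N, 0 ≤ᵐ[m] ∑ n ∈ Finset.range N, (P ^ n) g := fun N => by
      have : ∀ n, 0 ≤ᵐ[m] (P ^ n) g := fun n =>
        (hP.pow n).2.1 _ hg (Eventually.of_forall fun x => ENNReal.toReal_nonneg)
      filter_upwards [ae_all_iff.2 this] with x hx
      rw [Finset.sum_apply]
      exact Finset.sum_nonneg fun n _ => hx n
    intro N
    induction N with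
    | zero => simp
    | succ N ih =>
      filter_upwards [hP.ofReal_apply_le_of_le hf hf0 hmono hlim hPlim (hS N) (hS0 N) ih, hlt]
        with x hx hx'
      have heq : ∑ n ∈ Finset.range (N + 1), (P ^ n) g
          = P (∑ n ∈ Finset.range N, (P ^ n) g) + g := by
        rw [Finset.sum_range_succ', map_sum]
        simp [pow_succ']
      rw [heq, Pi.add_apply]
      calc _ ≤ Pu x + min (u x - Pu x) (w x) :=
            ENNReal.ofReal_add_le.trans (add_le_add hx (ENNReal.ofReal_toReal (hmin x)).le)
        _ ≤ Pu x + (u x - Pu x) := by gcongr; exact min_le_left _ _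
        _ = u x := add_tsub_cancel_of_le hx'.le

/-- If there exists a measurable, a.e. positive function `u` that is locally integrable
with respect to an admissible family `𝒜` and properly subinvariant for `P`, then `P` is
sweeping with respect to `𝒜`: `∫_A Pⁿ f dm → 0` for every `A ∈ 𝒜` and `f ∈ L¹`. -/
theorem sweeping_of_properlySubinvariant
    {X : Type*} [MeasurableSpace X] (m : Measure X) [SigmaFinite m]
    (P : (X → ℝ) →ₗ[ℝ] (X → ℝ)) (hP : IsMarkovOperator m P)
    (𝒜 : Set (Set X)) (h𝒜 : AdmissibleFamily m 𝒜)
    (u : X → ℝ≥0∞) (hu : Measurable u) (huPos : ∀ᵐ x ∂m, 0 < u x)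
    (huLoc : ∀ A ∈ 𝒜, ∫⁻ x in A, u x ∂m < ⊤)
    (hsub : ProperlySubinvariant m P u) :
    ∀ A ∈ 𝒜, ∀ f : X → ℝ, Integrable f m →
      Filter.Tendsto (fun n : ℕ => ∫ x in A, (P ^ n) f x ∂m) atTop (𝓝 0) := by
  intro A hA f hf
  obtain ⟨g, hg, hg0, hsum⟩ := hsub.exists_sum_pow_le hP hu.aemeasurable
  refine hP.tendsto_setIntegral_pow hg hg0 (Summable.tendsto_atTop_zero ?_) hf
  have hPg0 : ∀ n, 0 ≤ᵐ[m] (P ^ n) g := fun n =>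
    (hP.pow n).2.1 _ hg (hg0.mono fun x hx => hx.le)
  refine summable_of_sum_range_le (c := (∫⁻ x in A, u x ∂m).toReal)
    (fun n => integral_nonneg_of_ae (ae_restrict_of_ae (hPg0 n))) fun N => ?_
  rw [← integral_finsetSum _ fun n _ => ((hP.pow n).1 _ hg).integrableOn]
  have hnonneg : 0 ≤ᵐ[m] fun x => ∑ n ∈ Finset.range N, (P ^ n) g x := by
    filter_upwards [ae_all_iff.2 hPg0] with x hx
    exact Finset.sum_nonneg fun n _ => hx n
  rw [integral_eq_lintegral_of_nonneg_ae (ae_restrict_of_ae hnonneg)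
    (integrable_finsetSum _ fun n _ =>
      ((hP.pow n).1 _ hg).integrableOn).aestronglyMeasurable]
  refine ENNReal.toReal_mono (huLoc A hA).ne (lintegral_mono_ae (ae_restrict_of_ae ?_))
  filter_upwards [hsum N] with x hx
  simpa using hx
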